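/- arXiv:1108.2478 — 5 statements merged into one kernel-verified Lean document; each statement's English description precedes it below -/
import Mathlib

section
/- Consider the curved n-body problem on the surface M_κ² with κ ≠ 0, n ≥ 3 bodies and masses m_1,...,m_n > 0. Suppose q = (q_1,...,q_n) is a polygonal homographic solution, i.e., q_i(t) = (r(t)cos(ω(t)+α_i), r(t)sin(ω(t)+α_i), z(t)) with constants 0 ≤ α_1 < α_2 < ... < α_n < 2π, size function r(t) > 0, angular function ω(t), and z(t)² = σκ⁻¹ − σ r(t)², solving the equations of motion q_i'' = Σ_{j≠i} m_j |κ|^{3/2} [q_j − (κ q_i ⊙ q_j) q_i] / [σ − σ(κ q_i ⊙ q_j)²]^{3/2} − (κ q_i' ⊙ q_i') q_i for all t. If the function z is not constant, then the polygon is regular, i.e., α_{i+1} − α_i = 2π/n for all i = 1,...,n, where α_{n+1} := α_1 + 2π. -/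
open Real Finset

/-- The σ-inner product `a ⊙ b = aₓbₓ + a_y b_y + σ a_z b_z` on ℝ³. -/
def odot (σ : ℝ) (a b : Fin 3 → ℝ) : ℝ :=
  a 0 * b 0 + a 1 * b 1 + σ * (a 2 * b 2)

/-- The equations of motion of the curved `n`-body problem on `M_κ²`:
`q_i'' = Σ_{j≠i} m_j |κ|^{3/2} [q_j − (κ q_i ⊙ q_j) q_i] / [σ − σ(κ q_i ⊙ q_j)²]^{3/2}
          − (κ q_i' ⊙ q_i') q_i`. -/
def IsEOMSolution (κ σ : ℝ) (n : ℕ) (m : ℕ → ℝ) (q : ℕ → ℝ → (Fin 3 → ℝ)) : Prop :=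
  ∀ i ∈ Finset.Icc 1 n, ∀ t : ℝ,
    deriv (deriv (q i)) t =
      (∑ j ∈ (Finset.Icc 1 n).erase i,
        (m j * |κ| ^ ((3 : ℝ) / 2) /
            (σ - σ * (κ * odot σ (q i t) (q j t)) ^ 2) ^ ((3 : ℝ) / 2)) •
          (q j t - (κ * odot σ (q i t) (q j t)) • q i t))
      - (κ * odot σ (deriv (q i) t) (deriv (q i) t)) • q i t

/-- The functions `s ↦ (2 - s u) ^ (-3/2)` for distinct `u` are linearly independent on an open
interval. -/
theorem sum_filter_eq_zero_of_sum_rpow_eq_zero {ι : Type*} (T : Finset ι) (c u : ι → ℝ)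
    {a b : ℝ} (hab : a < b) (hpos : ∀ s ∈ Set.Ioo a b, ∀ k ∈ T, 0 < 2 - s * u k)
    (h : ∀ s ∈ Set.Ioo a b, ∑ k ∈ T, c k * (2 - s * u k) ^ (-(3 / 2 : ℝ)) = 0) (u₀ : ℝ) :
    ∑ k ∈ T with u k = u₀, c k = 0 := by
  have hder : ∀ p : ℕ, ∀ s ∈ Set.Ioo a b,
      ∑ k ∈ T, c k * u k ^ p * (2 - s * u k) ^ (-(3 / 2 : ℝ) - p) = 0 := by
    intro p
    induction p with
    | zero => simpa using h
    | succ p ih =>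
      intro s hs
      have hd : HasDerivAt (fun s => ∑ k ∈ T, c k * u k ^ p * (2 - s * u k) ^ (-(3 / 2 : ℝ) - p))
          (∑ k ∈ T, c k * u k ^ p *
            (-u k * (-(3 / 2 : ℝ) - p) * (2 - s * u k) ^ (-(3 / 2 : ℝ) - p - 1))) s := by
        refine HasDerivAt.fun_sum fun k hk => HasDerivAt.const_mul _ ?_
        refine HasDerivAt.rpow_const ?_ (Or.inl (hpos s hs k hk).ne')
        simpa using ((hasDerivAt_id s).mul_const (u k)).const_sub 2
      have h0 : HasDerivAt
          (fun s => ∑ k ∈ T, c k * u k ^ p * (2 - s * u k) ^ (-(3 / 2 : ℝ) - p)) 0 s := by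
        refine (hasDerivAt_const s (0 : ℝ)).congr_of_eventuallyEq ?_
        filter_upwards [isOpen_Ioo.mem_nhds hs] with x hx using ih x hx
      have he := hd.unique h0
      have hfac : ((3 / 2 : ℝ) + p) *
          ∑ k ∈ T, c k * u k ^ (p + 1) * (2 - s * u k) ^ (-(3 / 2 : ℝ) - (p + 1 : ℕ)) = 0 := by
        rw [← he, Finset.mul_sum]
        refine Finset.sum_congr rfl fun k _ => ?_
        rw [show (-(3 / 2 : ℝ) - (p + 1 : ℕ)) = -(3 / 2 : ℝ) - p - 1 by push_cast; ring]
        ring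
      exact (mul_eq_zero.mp hfac).resolve_left (by positivity)
  obtain ⟨s, hs⟩ : (Set.Ioo a b).Nonempty := Set.nonempty_Ioo.mpr hab
  set v : ι → ℝ := fun k => u k / (2 - s * u k) with hv
  have hvpow : ∀ p : ℕ, ∑ k ∈ T, c k * (2 - s * u k) ^ (-(3 / 2 : ℝ)) * v k ^ p = 0 := by
    intro p
    rw [← hder p s hs]
    refine Finset.sum_congr rfl fun k hk => ?_
    rw [Real.rpow_sub (hpos s hs k hk), Real.rpow_natCast, hv, div_pow]
    ring
  have hvpoly : ∀ Q : Polynomial ℝ,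
      ∑ k ∈ T, c k * (2 - s * u k) ^ (-(3 / 2 : ℝ)) * Q.eval (v k) = 0 := by
    intro Q
    simp_rw [Polynomial.eval_eq_sum_range, Finset.mul_sum]
    rw [Finset.sum_comm]
    refine Finset.sum_eq_zero fun p _ => ?_
    rw [← mul_zero (Q.coeff p), ← hvpow p, Finset.mul_sum]
    exact Finset.sum_congr rfl fun k _ => by ring
  have hvinj : ∀ k ∈ T, ∀ l ∈ T, v k = v l → u k = u l := by
    intro k hk l hl hkl
    rw [hv] at hkl
    have hkl' := (div_eq_div_iff (hpos s hs k hk).ne' (hpos s hs l hl).ne').mp hkl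
    linarith
  by_cases hex : ∃ k₀ ∈ T, u k₀ = u₀
  swap
  · push Not at hex
    rw [Finset.filter_false_of_mem hex, Finset.sum_empty]
  obtain ⟨k₀, hk₀, rfl⟩ := hex
  set Q : Polynomial ℝ :=
    ∏ x ∈ (T.image v).erase (v k₀), (Polynomial.X - Polynomial.C x) with hQ
  have hQ₀ : Q.eval (v k₀) ≠ 0 := by
    rw [hQ, Polynomial.eval_prod, Finset.prod_ne_zero_iff]
    intro x hx
    simpa [sub_eq_zero] using (Finset.ne_of_mem_erase hx).symm
  have hQk : ∀ k ∈ T, u k ≠ u k₀ → Q.eval (v k) = 0 := by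
    intro k hk hne
    rw [hQ, Polynomial.eval_prod]
    refine Finset.prod_eq_zero (Finset.mem_erase.mpr
      ⟨fun e => hne (hvinj k hk k₀ hk₀ e), Finset.mem_image_of_mem v hk⟩) ?_
    simp
  have hw : (2 - s * u k₀) ^ (-(3 / 2 : ℝ)) ≠ 0 := (Real.rpow_pos_of_pos (hpos s hs k₀ hk₀) _).ne'
  have hfin : (∑ k ∈ T with u k = u k₀, c k) *
      ((2 - s * u k₀) ^ (-(3 / 2 : ℝ)) * Q.eval (v k₀)) = 0 := by
    rw [← hvpoly Q, Finset.sum_mul, Finset.sum_filter]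
    refine Finset.sum_congr rfl fun k hk => ?_
    split_ifs with e
    · simp only [hv, e]
      ring
    · rw [hQk k hk e, mul_zero]
  exact (mul_eq_zero.mp hfin).resolve_right (mul_ne_zero hw hQ₀)

/-- A double sum of an antisymmetric function vanishes. -/
theorem sum_sum_eq_zero_of_antisymm {ι : Type*} (T : Finset ι) (f : ι → ι → ℝ)
    (hf : ∀ i j, f i j = -f j i) : ∑ i ∈ T, ∑ j ∈ T, f i j = 0 := by
  have h : ∑ i ∈ T, ∑ j ∈ T, f i j = -∑ i ∈ T, ∑ j ∈ T, f i j := by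
    conv_lhs => rw [Finset.sum_comm]
    simp_rw [← Finset.sum_neg_distrib]
    exact Finset.sum_congr rfl fun i _ => Finset.sum_congr rfl fun j _ => hf j i
  linarith

/-- A linear relation between coordinates of two curves passes to their derivatives. -/
theorem deriv_apply_eq_of_apply_eq {f g : ℝ → Fin 3 → ℝ} (hf : Differentiable ℝ f)
    (hg : Differentiable ℝ g) {l : Fin 3} {a b : ℝ}
    (h : ∀ t, f t l = a * g t 0 + b * g t 1) (t : ℝ) :
    deriv f t l = a * deriv g t 0 + b * deriv g t 1 := by
  have hf' := hasDerivAt_pi.mp (hf t).hasDerivAt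
  have hg' := hasDerivAt_pi.mp (hg t).hasDerivAt
  have h1 := hf' l
  rw [show (fun x => f x l) = fun x => a * g x 0 + b * g x 1 from funext h] at h1
  exact h1.unique (((hg' 0).const_mul a).add ((hg' 1).const_mul b))

/-- If a finite set of angles on the circle is invariant under reflection through each of its
members, then it is a regular polygon. -/
theorem gap_eq_of_reflection_invariant {n : ℕ} {α : ℕ → ℝ} (hα0 : 0 ≤ α 1)
    (hαmono : ∀ i, 1 ≤ i → i < n → α i < α (i + 1)) (hαlt : α n < 2 * π)
    (hαext : α (n + 1) = α 1 + 2 * π)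
    (hrefl : ∀ i ∈ Finset.Icc 1 n, ∀ j ∈ Finset.Icc 1 n, ∃ k ∈ Finset.Icc 1 n, ∃ N : ℤ,
      α k + 2 * π * N = 2 * α i - α j) :
    ∀ i ∈ Finset.Icc 1 n, α (i + 1) - α i = 2 * π / n := by
  have hπ := Real.pi_pos
  have hstep : ∀ i, 1 ≤ i → i ≤ n → α i < α (i + 1) := by
    intro i h1 hn
    rcases hn.lt_or_eq with h | rfl
    · exact hαmono i h1 h
    · linarith
  have hmono : ∀ i j, 1 ≤ i → i ≤ j → j ≤ n + 1 → α i ≤ α j := by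
    intro i j h1 hij
    induction j, hij using Nat.le_induction with
    | base => intro _; exact le_rfl
    | succ j hj ih => intro h; exact (ih (by omega)).trans (hstep j (by omega) (by omega)).le
  have hnext : ∀ i ∈ Finset.Icc 1 n, ∀ k ∈ Finset.Icc 1 n, ∀ N : ℤ,
      α i < α k + 2 * π * N → α (i + 1) ≤ α k + 2 * π * N := by
    intro i hi k hk N hlt
    rw [Finset.mem_Icc] at hi hk
    have hi1 := hmono 1 i le_rfl hi.1 (by omega)
    have hk1 := hmono 1 k le_rfl hk.1 (by omega)
    have hkn := hmono k n hk.1 hk.2 (by omega)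
    rcases lt_trichotomy N 0 with hN | rfl | hN
    · have : (N : ℝ) ≤ -1 := by exact_mod_cast (show N ≤ -1 by omega)
      nlinarith
    · simp only [Int.cast_zero, mul_zero, add_zero] at hlt ⊢
      refine hmono (i + 1) k (by omega) ?_ (by omega)
      by_contra hc
      exact absurd (hmono k i hk.1 (by omega) (by omega)) (not_le.mpr hlt)
    · have : (1 : ℝ) ≤ N := by exact_mod_cast (show 1 ≤ N by omega)
      have := hmono (i + 1) (n + 1) (by omega) (by omega) le_rfl
      nlinarith
  have hanti : ∀ i, 1 ≤ i → i < n → α (i + 1 + 1) - α (i + 1) ≤ α (i + 1) - α i := by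
    intro i h1 hn
    have hi : i + 1 ∈ Finset.Icc 1 n := Finset.mem_Icc.mpr ⟨by omega, by omega⟩
    obtain ⟨k, hk, N, hN⟩ := hrefl (i + 1) hi i (Finset.mem_Icc.mpr ⟨h1, hn.le⟩)
    have := hnext (i + 1) hi k hk N (by linarith [hstep i h1 hn.le])
    linarith
  have hle : ∀ i j, 1 ≤ i → i ≤ j → j ≤ n → α (j + 1) - α j ≤ α (i + 1) - α i := by
    intro i j h1 hij
    induction j, hij using Nat.le_induction with
    | base => intro _; exact le_rfl
    | succ j hj ih => intro h; exact (hanti j (by omega) (by omega)).trans (ih (by omega))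
  intro i hi
  rw [Finset.mem_Icc] at hi
  have hn1 : 1 ≤ n := hi.1.trans hi.2
  have hwrap : α (1 + 1) - α 1 ≤ α (n + 1) - α n := by
    have h1 : 1 ∈ Finset.Icc 1 n := Finset.mem_Icc.mpr ⟨le_rfl, hn1⟩
    obtain ⟨k, hk, N, hN⟩ := hrefl 1 h1 n (Finset.mem_Icc.mpr ⟨hn1, le_rfl⟩)
    have hN' : α k + 2 * π * ((N + 1 : ℤ) : ℝ) = 2 * α 1 - α n + 2 * π := by
      push_cast
      linarith
    have := hnext 1 h1 k hk (N + 1) (by rw [hN']; linarith)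
    linarith
  have hconst : ∀ j, 1 ≤ j → j ≤ n → α (j + 1) - α j = α (1 + 1) - α 1 := fun j h1 hn =>
    le_antisymm (hle 1 j le_rfl h1 hn) (hwrap.trans (hle j n h1 hn le_rfl))
  have hlin : ∀ j : ℕ, j ≤ n → α (j + 1) = α 1 + j * (α (1 + 1) - α 1) := by
    intro j
    induction j with
    | zero => simp
    | succ j ih =>
      intro h
      have h1 := ih (by omega)
      have h2 := hconst (j + 1) (by omega) h
      push_cast
      linarith
  have hn0 : (n : ℝ) ≠ 0 := by positivity
  rw [hconst i hi.1 hi.2, eq_div_iff hn0]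
  linarith [hlin n le_rfl]

/-- The torque on each body of a polygonal homographic solution vanishes. -/
theorem torque_eq_zero {κ σ : ℝ} {n : ℕ} {m : ℕ → ℝ} (hm : ∀ i ∈ Finset.Icc 1 n, 0 < m i)
    {α : ℕ → ℝ} {r ω z : ℝ → ℝ} (hr : ∀ t, 0 < r t) {q : ℕ → ℝ → (Fin 3 → ℝ)}
    (hq : ∀ i ∈ Finset.Icc 1 n, ∀ t : ℝ,
      q i t = ![r t * Real.cos (ω t + α i), r t * Real.sin (ω t + α i), z t])
    (hsmooth : ∀ i ∈ Finset.Icc 1 n, ContDiff ℝ 2 (q i))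
    (heom : IsEOMSolution κ σ n m q) (t : ℝ) :
    ∀ i ∈ Finset.Icc 1 n, ∑ j ∈ Finset.Icc 1 n,
      m j * |κ| ^ ((3 : ℝ) / 2) / (σ - σ * (κ * odot σ (q i t) (q j t)) ^ 2) ^ ((3 : ℝ) / 2) *
        Real.sin (α j - α i) = 0 := by
  intro i₀ hi₀
  have hdiff : ∀ i ∈ Finset.Icc 1 n, Differentiable ℝ (q i) := fun i hi =>
    (hsmooth i hi).differentiable (by norm_num)
  have hdiff' : ∀ i ∈ Finset.Icc 1 n, Differentiable ℝ (deriv (q i)) := fun i hi =>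
    (((contDiff_succ_iff_deriv (n := 1)).mp (hsmooth i hi)).2.2).differentiable (by norm_num)
  set f : ℕ → ℕ → ℝ := fun i j =>
    |κ| ^ ((3 : ℝ) / 2) / (σ - σ * (κ * odot σ (q i t) (q j t)) ^ 2) ^ ((3 : ℝ) / 2) with hf
  have hfsymm : ∀ i j, f i j = f j i := by
    intro i j
    have : odot σ (q i t) (q j t) = odot σ (q j t) (q i t) := by
      unfold odot
      ring
    simp only [hf, this]
  have hcross : ∀ i ∈ Finset.Icc 1 n,
      q i t 0 * deriv (deriv (q i)) t 1 - q i t 1 * deriv (deriv (q i)) t 0 =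
        r t ^ 2 * ∑ j ∈ Finset.Icc 1 n, m j * f i j * Real.sin (α j - α i) := by
    intro i hi
    rw [heom i hi t]
    simp only [Pi.sub_apply, Pi.smul_apply, Finset.sum_apply, smul_eq_mul]
    rw [← Finset.sum_erase (Finset.Icc 1 n) (a := i) (by simp), mul_sub, mul_sub, Finset.mul_sum,
      Finset.mul_sum, Finset.mul_sum, sub_sub_sub_comm, ← Finset.sum_sub_distrib]
    refine (sub_eq_self.mpr (by ring)).trans (Finset.sum_congr rfl fun j hj => ?_)
    rw [show α j - α i = (ω t + α j) - (ω t + α i) by ring, Real.sin_sub]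
    simp only [hf, hq i hi t, hq j (Finset.mem_of_mem_erase hj) t, Matrix.cons_val_zero,
      Matrix.cons_val_one]
    ring
  have hinv : ∀ i ∈ Finset.Icc 1 n,
      q i t 0 * deriv (deriv (q i)) t 1 - q i t 1 * deriv (deriv (q i)) t 0 =
        q i₀ t 0 * deriv (deriv (q i₀)) t 1 - q i₀ t 1 * deriv (deriv (q i₀)) t 0 := by
    intro i hi
    set δ := α i - α i₀ with hδ
    have hα : ∀ t, ω t + α i = (ω t + α i₀) + δ := fun t => by rw [hδ]; ring
    have h0 : ∀ t, q i t 0 = Real.cos δ * q i₀ t 0 + -Real.sin δ * q i₀ t 1 := by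
      intro t
      simp only [hq i hi t, hq i₀ hi₀ t, Matrix.cons_val_zero, Matrix.cons_val_one, hα,
        Real.cos_add]
      ring
    have h1 : ∀ t, q i t 1 = Real.sin δ * q i₀ t 0 + Real.cos δ * q i₀ t 1 := by
      intro t
      simp only [hq i hi t, hq i₀ hi₀ t, Matrix.cons_val_zero, Matrix.cons_val_one, hα,
        Real.sin_add]
      ring
    have h0' := deriv_apply_eq_of_apply_eq (hdiff' i hi) (hdiff' i₀ hi₀)
      (deriv_apply_eq_of_apply_eq (hdiff i hi) (hdiff i₀ hi₀) h0) t
    have h1' := deriv_apply_eq_of_apply_eq (hdiff' i hi) (hdiff' i₀ hi₀)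
      (deriv_apply_eq_of_apply_eq (hdiff i hi) (hdiff i₀ hi₀) h1) t
    rw [h0, h1, h0', h1']
    linear_combination (q i₀ t 0 * deriv (deriv (q i₀)) t 1 -
      q i₀ t 1 * deriv (deriv (q i₀)) t 0) * Real.sin_sq_add_cos_sq δ
  have hr2 : r t ^ 2 ≠ 0 := (pow_pos (hr t) 2).ne'
  have hsame : ∀ i ∈ Finset.Icc 1 n,
      ∑ j ∈ Finset.Icc 1 n, m j * f i j * Real.sin (α j - α i) =
        ∑ j ∈ Finset.Icc 1 n, m j * f i₀ j * Real.sin (α j - α i₀) := by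
    intro i hi
    refine mul_left_cancel₀ hr2 ?_
    rw [← hcross i hi, ← hcross i₀ hi₀, hinv i hi]
  have hdouble := sum_sum_eq_zero_of_antisymm (Finset.Icc 1 n)
    (fun i j => m i * (m j * f i j * Real.sin (α j - α i))) (by
      intro i j
      simp only [hfsymm i j]
      rw [← neg_sub (α i) (α j), Real.sin_neg]
      ring)
  simp_rw [← Finset.mul_sum] at hdouble
  rw [Finset.sum_congr rfl fun i hi => by rw [hsame i hi], ← Finset.sum_mul] at hdouble
  have hM : (∑ i ∈ Finset.Icc 1 n, m i) ≠ 0 := (Finset.sum_pos hm ⟨i₀, hi₀⟩).ne'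
  have hzero := (mul_eq_zero.mp hdouble).resolve_left hM
  rw [← hzero]
  exact Finset.sum_congr rfl fun j _ => by rw [hf, mul_div_assoc]

/-- A continuous real function whose square is constant is itself constant. -/
theorem eq_of_continuous_of_sq_eq {z : ℝ → ℝ} (hz : Continuous z)
    (h : ∀ s t, z s ^ 2 = z t ^ 2) (s t : ℝ) : z s = z t := by
  rcases sq_eq_sq_iff_eq_or_eq_neg.mp (h s t) with e | e
  · exact e
  obtain ⟨x, hx⟩ : (0 : ℝ) ∈ Set.range z := by
    rcases le_total (z s) 0 with hs | hs
    · exact mem_range_of_exists_le_of_exists_ge hz ⟨s, hs⟩ ⟨t, by linarith⟩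
    · exact mem_range_of_exists_le_of_exists_ge hz ⟨t, by linarith⟩ ⟨s, hs⟩
  have hs := h s x
  have ht := h t x
  rw [hx] at hs ht
  rw [show z s = 0 by simpa using hs, show z t = 0 by simpa using ht]

/-- **Non-existence of irregular polygonal homographic orbits.**
If a polygonal homographic solution of the curved `n`-body problem (`κ ≠ 0`, `n ≥ 3`,
positive masses) has non-constant `z`, then the underlying polygon is regular. -/
theorem no_irregular_polygonal_homographic_orbits
    (κ : ℝ) (hκ : κ ≠ 0) (σ : ℝ) (hσ : σ = if 0 < κ then 1 else -1)
    (n : ℕ) (hn : 3 ≤ n)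
    (m : ℕ → ℝ) (hm : ∀ i ∈ Finset.Icc 1 n, 0 < m i)
    (α : ℕ → ℝ)
    (hα0 : 0 ≤ α 1)
    (hαmono : ∀ i, 1 ≤ i → i < n → α i < α (i + 1))
    (hαlt : α n < 2 * π)
    (hαext : α (n + 1) = α 1 + 2 * π)
    (r ω z : ℝ → ℝ)
    (hr : ∀ t, 0 < r t)
    (hz : ∀ t, (z t) ^ 2 = σ * κ⁻¹ - σ * (r t) ^ 2)
    (q : ℕ → ℝ → (Fin 3 → ℝ))
    (hq : ∀ i ∈ Finset.Icc 1 n, ∀ t : ℝ,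
      q i t = ![r t * Real.cos (ω t + α i), r t * Real.sin (ω t + α i), z t])
    (hM : ∀ i ∈ Finset.Icc 1 n, ∀ t : ℝ,
      κ * ((q i t 0) ^ 2 + (q i t 1) ^ 2 + σ * (q i t 2) ^ 2) = 1)
    (hsmooth : ∀ i ∈ Finset.Icc 1 n, ContDiff ℝ 2 (q i))
    (heom : IsEOMSolution κ σ n m q)
    (hznotconst : ¬ ∃ c : ℝ, ∀ t : ℝ, z t = c) :
    ∀ i ∈ Finset.Icc 1 n, α (i + 1) - α i = 2 * π / n := by
  have hσκ : σ * κ = |κ| := by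
    rw [hσ]
    split_ifs with h
    · rw [abs_of_pos h, one_mul]
    · rw [abs_of_nonpos (not_lt.mp h), neg_one_mul]
  have hσ2 : σ * σ = 1 := by
    rw [hσ]
    split_ifs <;> norm_num
  have hκpos : 0 < |κ| := abs_pos.mpr hκ
  have h1n : 1 ∈ Finset.Icc 1 n := Finset.mem_Icc.mpr ⟨le_rfl, by omega⟩
  have hzcont : Continuous z := by
    have h := (continuous_apply (2 : Fin 3)).comp (hsmooth 1 h1n).continuous
    convert h using 1
    funext t
    simp [hq 1 h1n t]
  have hs : ∀ t, κ * r t ^ 2 = 1 - |κ| * z t ^ 2 := by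
    intro t
    rw [hz t, ← hσκ]
    linear_combination (1 : ℝ) * mul_inv_cancel₀ hκ +
      (κ * κ⁻¹ - κ * r t ^ 2) * hσ2
  obtain ⟨t₁, t₂, ht⟩ : ∃ t₁ t₂, 1 - |κ| * z t₁ ^ 2 < 1 - |κ| * z t₂ ^ 2 := by
    by_contra! hc
    refine hznotconst ⟨z 0, fun t => eq_of_continuous_of_sq_eq hzcont (fun a b => ?_) t 0⟩
    exact mul_left_cancel₀ hκpos.ne' (le_antisymm (by linarith [hc a b]) (by linarith [hc b a]))
  have hscont : Continuous fun t => 1 - |κ| * z t ^ 2 := by fun_prop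
  have hfield : ∀ i ∈ Finset.Icc 1 n,
      ∀ s ∈ Set.Ioo (1 - |κ| * z t₁ ^ 2) (1 - |κ| * z t₂ ^ 2),
      ∀ j ∈ Finset.Icc 1 n, 0 < 2 - s * (1 - Real.cos (α j - α i)) := by
    intro i _ s hs' j _
    have hs1 : s < 1 := hs'.2.trans_le (by nlinarith [sq_nonneg (z t₂)])
    have hu0 := Real.cos_le_one (α j - α i)
    have hu2 := Real.neg_one_le_cos (α j - α i)
    rcases hu0.eq_or_lt with e | hlt
    · rw [e]
      norm_num
    · nlinarith [mul_lt_mul_of_pos_right hs1 (sub_pos.mpr hlt)]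
  have hvanish : ∀ i ∈ Finset.Icc 1 n,
      ∀ s ∈ Set.Ioo (1 - |κ| * z t₁ ^ 2) (1 - |κ| * z t₂ ^ 2),
      ∑ j ∈ Finset.Icc 1 n, m j * Real.sin (α j - α i) *
        ((1 - Real.cos (α j - α i)) ^ ((3 : ℝ) / 2))⁻¹ *
        (2 - s * (1 - Real.cos (α j - α i))) ^ (-(3 / 2 : ℝ)) = 0 := by
    intro i hi s hs'
    obtain ⟨t, rfl⟩ : s ∈ Set.range fun t => 1 - |κ| * z t ^ 2 :=
      mem_range_of_exists_le_of_exists_ge hscont ⟨t₁, hs'.1.le⟩ ⟨t₂, hs'.2.le⟩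
    have htorque := torque_eq_zero hm hr hq hsmooth heom t i hi
    have hrpos : 0 < r t ^ 2 := pow_pos (hr t) 2
    have hK : |κ| ^ ((3 : ℝ) / 2) / (|κ| * r t ^ 2) ^ ((3 : ℝ) / 2) ≠ 0 := by positivity
    refine (mul_eq_zero.mp ?_).resolve_left hK
    rw [← htorque, Finset.mul_sum]
    refine Finset.sum_congr rfl fun j hj => ?_
    have hpos := hfield i hi _ hs' j hj
    have hu : 0 ≤ 1 - Real.cos (α j - α i) := sub_nonneg.mpr (Real.cos_le_one _)
    simp only at hpos ⊢
    rw [← hs t] at hpos ⊢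
    have hodot : κ * odot σ (q i t) (q j t) =
        1 - κ * r t ^ 2 * (1 - Real.cos (α j - α i)) := by
      rw [show α j - α i = (ω t + α j) - (ω t + α i) by ring, Real.cos_sub, hq i hi t, hq j hj t]
      simp only [odot, Matrix.cons_val_zero, Matrix.cons_val_one, Matrix.cons_val]
      linear_combination (κ * σ) * hz t + mul_inv_cancel₀ hκ + (κ * κ⁻¹ - κ * r t ^ 2) * hσ2
    have hbase : σ - σ * (κ * odot σ (q i t) (q j t)) ^ 2 =
        |κ| * r t ^ 2 * (1 - Real.cos (α j - α i)) *
          (2 - κ * r t ^ 2 * (1 - Real.cos (α j - α i))) := by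
      rw [hodot, ← hσκ]
      ring
    rw [hbase, Real.mul_rpow (by positivity) hpos.le, Real.mul_rpow (by positivity) hu,
      Real.rpow_neg hpos.le]
    simp only [div_eq_mul_inv, mul_inv]
    ring
  refine gap_eq_of_reflection_invariant hα0 hαmono hαlt hαext fun i hi j hj => ?_
  suffices hk : ∃ k ∈ Finset.Icc 1 n, Real.cos (α k - α i) = Real.cos (α j - α i) ∧
      Real.sin (α k - α i) = -Real.sin (α j - α i) by
    obtain ⟨k, hk, hcos, hsin⟩ := hk
    have hangle : Real.cos ((α k - α i) + (α j - α i)) = 1 := by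
      rw [Real.cos_add, hcos, hsin]
      linear_combination Real.sin_sq_add_cos_sq (α j - α i)
    obtain ⟨N, hN⟩ := (Real.cos_eq_one_iff _).mp hangle
    refine ⟨k, hk, -N, ?_⟩
    push_cast
    linarith
  by_contra! hne
  have hsin0 : Real.sin (α j - α i) ≠ 0 := fun h0 => hne j hj rfl (by rw [h0, neg_zero])
  have hcos1 : 0 < 1 - Real.cos (α j - α i) := by
    refine sub_pos.mpr ((Real.cos_le_one _).lt_of_ne fun e => hsin0 ?_)
    have := Real.sin_sq_add_cos_sq (α j - α i)
    rw [e] at this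
    nlinarith
  have hsum := sum_filter_eq_zero_of_sum_rpow_eq_zero (Finset.Icc 1 n) _ _ ht (hfield i hi)
    (hvanish i hi) (1 - Real.cos (α j - α i))
  have hterm : ∀ k ∈ (Finset.Icc 1 n).filter
      fun k => 1 - Real.cos (α k - α i) = 1 - Real.cos (α j - α i),
      m k * Real.sin (α k - α i) * ((1 - Real.cos (α k - α i)) ^ ((3 : ℝ) / 2))⁻¹ =
        m k * (Real.sin (α j - α i) * ((1 - Real.cos (α j - α i)) ^ ((3 : ℝ) / 2))⁻¹) := by
    intro k hk
    obtain ⟨hk, hu⟩ := Finset.mem_filter.mp hk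
    have hcos : Real.cos (α k - α i) = Real.cos (α j - α i) := by linarith
    have hsq : Real.sin (α k - α i) ^ 2 = Real.sin (α j - α i) ^ 2 := by
      rw [Real.sin_sq, Real.sin_sq, hcos]
    rw [hu, (sq_eq_sq_iff_eq_or_eq_neg.mp hsq).resolve_right (hne k hk hcos)]
    ring
  rw [Finset.sum_congr rfl hterm, ← Finset.sum_mul] at hsum
  have hmass : (∑ k ∈ Finset.Icc 1 n with 1 - Real.cos (α k - α i) = 1 - Real.cos (α j - α i),
      m k) ≠ 0 :=
    have hnonempty : ((Finset.Icc 1 n).filter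
        fun k => 1 - Real.cos (α k - α i) = 1 - Real.cos (α j - α i)).Nonempty :=
      ⟨j, Finset.mem_filter.mpr ⟨hj, rfl⟩⟩
    (Finset.sum_pos (fun k hk => hm k (Finset.mem_filter.mp hk).1) hnonempty).ne'
  exact mul_ne_zero hmass (mul_ne_zero hsin0
    (inv_ne_zero (Real.rpow_pos_of_pos hcos1 _).ne')) hsum
end

section
/- Let n ≥ 3, let m_1,...,m_n > 0 be real numbers, and let 0 ≤ α_1 < α_2 < ... < α_n < 2π with α_{n+1} := α_1 + 2π. Suppose there is a nondegenerate open interval I ⊆ ℝ such that 2 − c_ji ρ > 0 for all ρ ∈ I and all i ≠ j, and such that for every ρ ∈ I the equations δ_1(ρ) = δ_2(ρ) = ... = δ_n(ρ) and γ_1(ρ) = γ_2(ρ) = ... = γ_n(ρ) hold. Then the polygon is regular: α_{i+1} − α_i = 2π/n for all i = 1,...,n. -/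
open Real Finset

/-- `s_ji = sin(α_j − α_i)`. -/
noncomputable def sAng (α : ℕ → ℝ) (j i : ℕ) : ℝ := Real.sin (α j - α i)

/-- `c_ji = 1 − cos(α_j − α_i)`. -/
noncomputable def cAng (α : ℕ → ℝ) (j i : ℕ) : ℝ := 1 - Real.cos (α j - α i)

/-- `μ_ji = 1/(c_ji^{1/2} (2 − c_ji ρ)^{3/2})`. -/
noncomputable def muF (α : ℕ → ℝ) (ρ : ℝ) (j i : ℕ) : ℝ :=
  1 / ((cAng α j i) ^ ((1 : ℝ) / 2) * (2 - cAng α j i * ρ) ^ ((3 : ℝ) / 2))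

/-- `ν_ji = s_ji/(c_ji^{3/2} (2 − c_ji ρ)^{3/2})`. -/
noncomputable def nuF (α : ℕ → ℝ) (ρ : ℝ) (j i : ℕ) : ℝ :=
  sAng α j i / ((cAng α j i) ^ ((3 : ℝ) / 2) * (2 - cAng α j i * ρ) ^ ((3 : ℝ) / 2))

/-- `δ_i = Σ_{j≠i} m_j μ_ji`. -/
noncomputable def deltaF (n : ℕ) (m : ℕ → ℝ) (α : ℕ → ℝ) (ρ : ℝ) (i : ℕ) : ℝ :=
  ∑ j ∈ (Finset.Icc 1 n).erase i, m j * muF α ρ j i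

/-- `γ_i = Σ_{j≠i} m_j ν_ji`. -/
noncomputable def gammaF (n : ℕ) (m : ℕ → ℝ) (α : ℕ → ℝ) (ρ : ℝ) (i : ℕ) : ℝ :=
  ∑ j ∈ (Finset.Icc 1 n).erase i, m j * nuF α ρ j i

/-- Differentiating a vanishing combination of the functions `ρ ↦ (2 - c ρ) ^ (-3/2)` `k` times. -/
lemma sum_mul_pow_mul_rpow_eq_zero {ι : Type*} (S : Finset ι) (w c : ι → ℝ) {a b : ℝ}
    (hpos : ∀ ρ ∈ Set.Ioo a b, ∀ j ∈ S, 0 < 2 - c j * ρ)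
    (h : ∀ ρ ∈ Set.Ioo a b, ∑ j ∈ S, w j * (2 - c j * ρ) ^ (-(3 / 2) : ℝ) = 0) (k : ℕ) :
    ∀ ρ ∈ Set.Ioo a b, ∑ j ∈ S, w j * c j ^ k * (2 - c j * ρ) ^ (-(3 / 2) - k : ℝ) = 0 := by
  induction k with
  | zero => simpa using h
  | succ k ih =>
    intro ρ hρ
    have hd : HasDerivAt (fun t ↦ ∑ j ∈ S, w j * c j ^ k * (2 - c j * t) ^ (-(3 / 2) - k : ℝ))
        (∑ j ∈ S, w j * c j ^ k *
          (-c j * (-(3 / 2) - k : ℝ) * (2 - c j * ρ) ^ ((-(3 / 2) - k : ℝ) - 1))) ρ := by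
      refine HasDerivAt.fun_sum fun j hj ↦ HasDerivAt.const_mul _ ?_
      have hl : HasDerivAt (fun t ↦ 2 - c j * t) (-c j) ρ := by
        simpa using ((hasDerivAt_id ρ).const_mul (c j)).const_sub 2
      exact hl.rpow_const (Or.inl (hpos ρ hρ j hj).ne')
    have hz : HasDerivAt (fun t ↦ ∑ j ∈ S, w j * c j ^ k * (2 - c j * t) ^ (-(3 / 2) - k : ℝ))
        0 ρ := by
      refine (hasDerivAt_const ρ (0 : ℝ)).congr_of_eventuallyEq ?_
      filter_upwards [isOpen_Ioo.mem_nhds hρ] with t ht using ih t ht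
    have heq := hd.unique hz
    have hfac : (3 / 2 + k : ℝ) *
        ∑ j ∈ S, w j * c j ^ (k + 1) * (2 - c j * ρ) ^ (-(3 / 2) - (k + 1 : ℕ) : ℝ) = 0 := by
      rw [← heq, Finset.mul_sum]
      refine Finset.sum_congr rfl fun j _ ↦ ?_
      rw [show (-(3 / 2) - (k + 1 : ℕ) : ℝ) = -(3 / 2) - k - 1 by push_cast; ring]
      ring
    exact (mul_eq_zero.mp hfac).resolve_left (by positivity)

/-- A finitely supported signed measure all of whose moments vanish integrates every function
to zero. -/
lemma sum_mul_apply_eq_zero_of_moments {ι : Type*} (S : Finset ι) (u x : ι → ℝ)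
    (h : ∀ k : ℕ, ∑ j ∈ S, u j * x j ^ k = 0) (g : ℝ → ℝ) : ∑ j ∈ S, u j * g (x j) = 0 := by
  classical
  set P := Lagrange.interpolate (S.image x) id g
  have hP : ∀ j ∈ S, P.eval (x j) = g (x j) := fun j hj ↦
    Lagrange.eval_interpolate_at_node g Function.injective_id.injOn (Finset.mem_image_of_mem x hj)
  calc ∑ j ∈ S, u j * g (x j)
      = ∑ j ∈ S, ∑ k ∈ Finset.range (P.natDegree + 1), P.coeff k * (u j * x j ^ k) := by
        refine Finset.sum_congr rfl fun j hj ↦ ?_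
        rw [← hP j hj, Polynomial.eval_eq_sum_range, Finset.mul_sum]
        exact Finset.sum_congr rfl fun k _ ↦ by ring
    _ = 0 := by
        rw [Finset.sum_comm]
        exact Finset.sum_eq_zero fun k _ ↦ by rw [← Finset.mul_sum, h k, mul_zero]

/-- Linear independence of the functions `ρ ↦ (2 - c ρ) ^ (-3/2)` on an interval, stated without
grouping equal values of `c`. -/
lemma sum_mul_apply_eq_zero_of_sum_rpow {ι : Type*} (S : Finset ι) (w c : ι → ℝ) {a b : ℝ}
    (hab : a < b) (hpos : ∀ ρ ∈ Set.Ioo a b, ∀ j ∈ S, 0 < 2 - c j * ρ)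
    (h : ∀ ρ ∈ Set.Ioo a b, ∑ j ∈ S, w j * (2 - c j * ρ) ^ (-(3 / 2) : ℝ) = 0) (g : ℝ → ℝ) :
    ∑ j ∈ S, w j * g (c j) = 0 := by
  obtain ⟨r, hr⟩ := Set.nonempty_Ioo.mpr hab
  have hmom : ∀ k : ℕ, ∑ j ∈ S,
      (w j * (2 - c j * r) ^ (-(3 / 2) : ℝ)) * (c j / (2 - c j * r)) ^ k = 0 := by
    intro k
    rw [← sum_mul_pow_mul_rpow_eq_zero S w c hpos h k r hr]
    refine Finset.sum_congr rfl fun j hj ↦ ?_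
    rw [Real.rpow_sub (hpos r hr j hj), Real.rpow_natCast, div_pow]
    ring
  rw [← sum_mul_apply_eq_zero_of_moments S _ _ hmom
    fun x ↦ g (2 * x / (1 + r * x)) * (2 - 2 * x / (1 + r * x) * r) ^ (3 / 2 : ℝ)]
  refine Finset.sum_congr rfl fun j hj ↦ ?_
  have hp := hpos r hr j hj
  have hc : 2 * (c j / (2 - c j * r)) / (1 + r * (c j / (2 - c j * r))) = c j := by
    have h1 : 1 + r * (c j / (2 - c j * r)) = 2 / (2 - c j * r) := by
      rw [eq_div_iff hp.ne', add_mul, mul_assoc, div_mul_cancel₀ _ hp.ne']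
      ring
    rw [h1]
    field_simp
  have hpow := (Real.rpow_pos_of_pos hp (3 / 2)).ne'
  simp only [hc]
  rw [Real.rpow_neg hp.le]
  field_simp

lemma sum_mul_apply_eq_of_sum_rpow_eq {ι : Type*} (S T : Finset ι) (w c v d : ι → ℝ) {a b : ℝ}
    (hab : a < b) (hpos : ∀ ρ ∈ Set.Ioo a b, ∀ j ∈ S, 0 < 2 - c j * ρ)
    (hpos' : ∀ ρ ∈ Set.Ioo a b, ∀ j ∈ T, 0 < 2 - d j * ρ)
    (h : ∀ ρ ∈ Set.Ioo a b, ∑ j ∈ S, w j * (2 - c j * ρ) ^ (-(3 / 2) : ℝ) =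
      ∑ j ∈ T, v j * (2 - d j * ρ) ^ (-(3 / 2) : ℝ)) (g : ℝ → ℝ) :
    ∑ j ∈ S, w j * g (c j) = ∑ j ∈ T, v j * g (d j) := by
  have := sum_mul_apply_eq_zero_of_sum_rpow (S.disjSum T) (Sum.elim w fun j ↦ -v j)
    (Sum.elim c d) hab
    (by
      intro ρ hρ j hj
      rcases j with j | j
      · exact hpos ρ hρ j (by simpa using hj)
      · exact hpos' ρ hρ j (by simpa using hj))
    (by
      intro ρ hρ
      simp [Finset.sum_disjSum, h ρ hρ]) g
  simp only [Finset.sum_disjSum, Sum.elim_inl, Sum.elim_inr, neg_mul, Finset.sum_neg_distrib]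
    at this
  linarith

/-- The criterion forces the masses seen from a vertex at a given angle to be independent of the
vertex; the two angles with the same cosine are separated by means of the sine. -/
lemma sum_mass_mul_indicator_eq {n : ℕ} {m α : ℕ → ℝ} {a b : ℝ} (hab : a < b)
    (hpos : ∀ ρ ∈ Set.Ioo a b, ∀ i ∈ Finset.Icc 1 n, ∀ j ∈ Finset.Icc 1 n, j ≠ i →
      0 < 2 - cAng α j i * ρ)
    (hcrit : ∀ ρ ∈ Set.Ioo a b, ∀ i ∈ Finset.Icc 1 n, ∀ i' ∈ Finset.Icc 1 n,
      deltaF n m α ρ i = deltaF n m α ρ i' ∧ gammaF n m α ρ i = gammaF n m α ρ i')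
    {c₀ : ℝ} (hc₀ : 0 < c₀) (s₀ : ℝ)
    {i : ℕ} (hi : i ∈ Finset.Icc 1 n) {i' : ℕ} (hi' : i' ∈ Finset.Icc 1 n) :
    ∑ j ∈ (Finset.Icc 1 n).erase i, m j * (s₀ + sAng α j i) * (if cAng α j i = c₀ then 1 else 0) =
      ∑ j ∈ (Finset.Icc 1 n).erase i',
        m j * (s₀ + sAng α j i') * (if cAng α j i' = c₀ then 1 else 0) := by
  have hp : ∀ i ∈ Finset.Icc 1 n, ∀ ρ ∈ Set.Ioo a b, ∀ j ∈ (Finset.Icc 1 n).erase i,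
      0 < 2 - cAng α j i * ρ := fun i hi ρ hρ j hj ↦
    hpos ρ hρ i hi j (Finset.mem_of_mem_erase hj) (Finset.ne_of_mem_erase hj)
  have hδ : ∀ i ∈ Finset.Icc 1 n, ∀ ρ ∈ Set.Ioo a b, deltaF n m α ρ i =
      ∑ j ∈ (Finset.Icc 1 n).erase i,
        m j / cAng α j i ^ (1 / 2 : ℝ) * (2 - cAng α j i * ρ) ^ (-(3 / 2) : ℝ) := by
    intro i hi ρ hρ
    refine Finset.sum_congr rfl fun j hj ↦ ?_
    rw [Real.rpow_neg (hp i hi ρ hρ j hj).le, muF, ← div_eq_mul_inv, div_div, mul_one_div]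
  have hγ : ∀ i ∈ Finset.Icc 1 n, ∀ ρ ∈ Set.Ioo a b, gammaF n m α ρ i =
      ∑ j ∈ (Finset.Icc 1 n).erase i,
        m j * sAng α j i / cAng α j i ^ (3 / 2 : ℝ) * (2 - cAng α j i * ρ) ^ (-(3 / 2) : ℝ) := by
    intro i hi ρ hρ
    refine Finset.sum_congr rfl fun j hj ↦ ?_
    rw [Real.rpow_neg (hp i hi ρ hρ j hj).le, nuF, div_eq_mul_inv, mul_inv, div_eq_mul_inv]
    ring
  have h1 := sum_mul_apply_eq_of_sum_rpow_eq _ _ _ _ _ _ hab (hp i hi) (hp i' hi')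
    (fun ρ hρ ↦ by
      rw [← hδ i hi ρ hρ, ← hδ i' hi' ρ hρ]
      exact (hcrit ρ hρ i hi i' hi').1) fun c ↦ if c = c₀ then s₀ * c₀ ^ (1 / 2 : ℝ) else 0
  have h2 := sum_mul_apply_eq_of_sum_rpow_eq _ _ _ _ _ _ hab (hp i hi) (hp i' hi')
    (fun ρ hρ ↦ by
      rw [← hγ i hi ρ hρ, ← hγ i' hi' ρ hρ]
      exact (hcrit ρ hρ i hi i' hi').2) fun c ↦ if c = c₀ then c₀ ^ (3 / 2 : ℝ) else 0
  have key : ∀ i, ∑ j ∈ (Finset.Icc 1 n).erase i,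
      m j * (s₀ + sAng α j i) * (if cAng α j i = c₀ then 1 else 0) =
      (∑ j ∈ (Finset.Icc 1 n).erase i, m j / cAng α j i ^ (1 / 2 : ℝ) *
        (if cAng α j i = c₀ then s₀ * c₀ ^ (1 / 2 : ℝ) else 0)) +
      ∑ j ∈ (Finset.Icc 1 n).erase i, m j * sAng α j i / cAng α j i ^ (3 / 2 : ℝ) *
        (if cAng α j i = c₀ then c₀ ^ (3 / 2 : ℝ) else 0) := by
    intro i
    rw [← Finset.sum_add_distrib]
    refine Finset.sum_congr rfl fun j _ ↦ ?_
    split_ifs with hc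
    · rw [hc]
      have e1 := (Real.rpow_pos_of_pos hc₀ (1 / 2)).ne'
      have e2 := (Real.rpow_pos_of_pos hc₀ (3 / 2)).ne'
      rw [mul_one, div_mul_cancel₀ _ e2, mul_comm s₀, ← mul_assoc, div_mul_cancel₀ _ e1]
      ring
    · simp
  rw [key, key, h1, h2]

/-- Every vertex of the polygon sees another vertex at the angle `θ` if one of them does. -/
lemma exists_vertex_at_angle {n : ℕ} {m α : ℕ → ℝ} (hm : ∀ i ∈ Finset.Icc 1 n, 0 < m i)
    {a b : ℝ} (hab : a < b)
    (hpos : ∀ ρ ∈ Set.Ioo a b, ∀ i ∈ Finset.Icc 1 n, ∀ j ∈ Finset.Icc 1 n, j ≠ i →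
      0 < 2 - cAng α j i * ρ)
    (hcrit : ∀ ρ ∈ Set.Ioo a b, ∀ i ∈ Finset.Icc 1 n, ∀ i' ∈ Finset.Icc 1 n,
      deltaF n m α ρ i = deltaF n m α ρ i' ∧ gammaF n m α ρ i = gammaF n m α ρ i')
    {θ : ℝ} (hθ0 : 0 < θ) (hθπ : θ < π) {k l : ℕ} (hk : k ∈ Finset.Icc 1 n)
    (hl : l ∈ Finset.Icc 1 n) (hlk : l ≠ k) (hsin : Real.sin (α l - α k) = Real.sin θ)
    (hcos : Real.cos (α l - α k) = Real.cos θ) {i : ℕ} (hi : i ∈ Finset.Icc 1 n) :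
    ∃ j ∈ Finset.Icc 1 n, j ≠ i ∧ ((α j - α i : ℝ) : Real.Angle) = (θ : ℝ) := by
  have hs : 0 < Real.sin θ := Real.sin_pos_of_pos_of_lt_pi hθ0 hθπ
  have hc : 0 < 1 - Real.cos θ := by
    have := Real.cos_lt_cos_of_nonneg_of_le_pi le_rfl hθπ.le hθ0
    rw [Real.cos_zero] at this
    linarith
  have hsq : ∀ j i, cAng α j i = 1 - Real.cos θ →
      sAng α j i = Real.sin θ ∨ sAng α j i = -Real.sin θ := by
    intro j i h
    rw [cAng, sub_right_inj] at h
    refine sq_eq_sq_iff_eq_or_eq_neg.mp ?_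
    rw [sAng, Real.sin_sq, Real.sin_sq, h]
  have hsum : 0 < ∑ j ∈ (Finset.Icc 1 n).erase k,
      m j * (Real.sin θ + sAng α j k) * (if cAng α j k = 1 - Real.cos θ then 1 else 0) := by
    refine Finset.sum_pos' (fun j hj ↦ ?_) ⟨l, Finset.mem_erase.mpr ⟨hlk, hl⟩, ?_⟩
    · have hmj := hm j (Finset.mem_of_mem_erase hj)
      split_ifs with h
      · rcases hsq j k h with h' | h' <;> rw [h']
        · positivity
        · simp
      · simp
    · have hml := hm l hl
      rw [if_pos (by rw [cAng, hcos]), sAng, hsin]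
      positivity
  rw [sum_mass_mul_indicator_eq hab hpos hcrit hc (Real.sin θ) hk hi] at hsum
  obtain ⟨j, hj, hne⟩ := Finset.exists_ne_zero_of_sum_ne_zero hsum.ne'
  refine ⟨j, Finset.mem_of_mem_erase hj, Finset.ne_of_mem_erase hj, ?_⟩
  have hcj : cAng α j i = 1 - Real.cos θ := by
    by_contra h
    simp [h] at hne
  have hsj : sAng α j i = Real.sin θ := by
    refine (hsq j i hcj).resolve_right fun h ↦ ?_
    simp [h] at hne
  rw [cAng, sub_right_inj] at hcj
  exact Real.Angle.cos_sin_inj hcj hsj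

/-- If `δ_1 = ... = δ_n` and `γ_1 = ... = γ_n` hold on a nondegenerate open interval of
values of `ρ`, then the polygon is regular: `α_{i+1} − α_i = 2π/n` for all `i`. -/
theorem regular_of_criterion_on_interval
    (n : ℕ) (hn : 3 ≤ n)
    (m : ℕ → ℝ) (hm : ∀ i ∈ Finset.Icc 1 n, 0 < m i)
    (α : ℕ → ℝ)
    (hα0 : 0 ≤ α 1)
    (hαmono : ∀ i, 1 ≤ i → i < n → α i < α (i + 1))
    (hαlt : α n < 2 * π)
    (hαext : α (n + 1) = α 1 + 2 * π)
    (a b : ℝ) (hab : a < b)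
    (hpos : ∀ ρ ∈ Set.Ioo a b, ∀ i ∈ Finset.Icc 1 n, ∀ j ∈ Finset.Icc 1 n, j ≠ i →
      0 < 2 - cAng α j i * ρ)
    (hcrit : ∀ ρ ∈ Set.Ioo a b, ∀ i ∈ Finset.Icc 1 n, ∀ i' ∈ Finset.Icc 1 n,
      deltaF n m α ρ i = deltaF n m α ρ i' ∧ gammaF n m α ρ i = gammaF n m α ρ i') :
    ∀ i ∈ Finset.Icc 1 n, α (i + 1) - α i = 2 * π / n := by
  have hlast : α n < α (n + 1) := by linarith
  have hmono : StrictMonoOn α (Set.Icc 1 (n + 1)) := by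
    refine strictMonoOn_of_lt_succ Set.ordConnected_Icc fun i _ hi hi' ↦ ?_
    rw [Nat.succ_eq_succ, Nat.succ_eq_add_one] at *
    rcases Nat.lt_or_ge i n with h | h
    · exact hαmono i hi.1 h
    · rwa [show i = n from le_antisymm (by simpa using hi'.2) h]
  have htel : ∑ i ∈ Finset.Icc 1 n, (α (i + 1) - α i) = 2 * π := by
    rw [← Finset.Ico_add_one_right_eq_Icc, Finset.sum_Ico_sub α (by omega), hαext]
    ring
  obtain ⟨k, hk, hmin⟩ := Finset.exists_min_image (Finset.Icc 1 n) (fun i ↦ α (i + 1) - α i)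
    ⟨1, Finset.mem_Icc.mpr ⟨le_rfl, by omega⟩⟩
  have hk' := Finset.mem_Icc.mp hk
  set θ := α (k + 1) - α k with hθ
  have hθ0 : 0 < θ :=
    sub_pos.mpr (hmono ⟨hk'.1, by omega⟩ ⟨by omega, by omega⟩ (Nat.lt_succ_self k))
  have hn' : (3 : ℝ) ≤ n := by exact_mod_cast hn
  have hθπ : θ < π := by
    have h := Finset.card_nsmul_le_sum _ _ _ hmin
    rw [htel, Nat.card_Icc, Nat.add_sub_cancel, nsmul_eq_mul] at h
    nlinarith [Real.pi_pos]
  obtain ⟨l, hl, hlk, hsin, hcos⟩ : ∃ l ∈ Finset.Icc 1 n, l ≠ k ∧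
      Real.sin (α l - α k) = Real.sin θ ∧ Real.cos (α l - α k) = Real.cos θ := by
    rcases hk'.2.lt_or_eq with h | h
    · exact ⟨k + 1, Finset.mem_Icc.mpr ⟨by omega, h⟩, by omega, rfl, rfl⟩
    · have : α 1 - α k = θ - 2 * π := by rw [hθ, h, hαext]; ring
      refine ⟨1, Finset.mem_Icc.mpr ⟨le_rfl, by omega⟩, by omega, ?_, ?_⟩
      · rw [this, Real.sin_sub_two_pi]
      · rw [this, Real.cos_sub_two_pi]
  have hgap : ∀ i ∈ Finset.Icc 1 n, α (i + 1) - α i = θ := by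
    intro i hi
    refine le_antisymm ?_ (hmin i hi)
    obtain ⟨j, hj, hji, hang⟩ :=
      exists_vertex_at_angle hm hab hpos hcrit hθ0 hθπ hk hl hlk hsin hcos hi
    rw [Finset.mem_Icc] at hi hj
    obtain ⟨z, hz⟩ := Real.Angle.angle_eq_iff_two_pi_dvd_sub.mp hang
    have hin : α i ≤ α n := hmono.monotoneOn ⟨hi.1, by omega⟩ ⟨by omega, by omega⟩ hi.2
    have hjn : α j ≤ α n := hmono.monotoneOn ⟨hj.1, by omega⟩ ⟨by omega, by omega⟩ hj.2
    have h1i : α 1 ≤ α i := hmono.monotoneOn ⟨le_rfl, by omega⟩ ⟨hi.1, by omega⟩ hi.1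
    have h1j : α 1 ≤ α j := hmono.monotoneOn ⟨le_rfl, by omega⟩ ⟨hj.1, by omega⟩ hj.1
    have hπ := Real.pi_pos
    rcases hji.lt_or_gt with h | h
    · have hlt : α j < α i := hmono ⟨hj.1, by omega⟩ ⟨hi.1, by omega⟩ h
      have hz1 : z < 0 := by
        have : (z : ℝ) < 0 := by nlinarith
        exact_mod_cast this
      have hz2 : -2 < z := by
        have : (-2 : ℝ) < z := by nlinarith
        exact_mod_cast this
      obtain rfl : z = -1 := by omega
      push_cast at hz
      have : α (i + 1) ≤ α (n + 1) :=
        hmono.monotoneOn ⟨by omega, by omega⟩ ⟨by omega, le_rfl⟩ (by omega)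
      linarith
    · have hlt : α i < α j := hmono ⟨hi.1, by omega⟩ ⟨hj.1, by omega⟩ h
      have hz1 : -1 < z := by
        have : (-1 : ℝ) < z := by nlinarith
        exact_mod_cast this
      have hz2 : z < 1 := by
        have : (z : ℝ) < 1 := by nlinarith
        exact_mod_cast this
      obtain rfl : z = 0 := by omega
      push_cast at hz
      have : α (i + 1) ≤ α j := hmono.monotoneOn ⟨by omega, by omega⟩ ⟨hj.1, by omega⟩ h
      linarith
  intro i hi
  rw [Finset.sum_congr rfl hgap, Finset.sum_const, Nat.card_Icc, Nat.add_sub_cancel,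
    nsmul_eq_mul] at htel
  rw [hgap i hi, eq_div_iff (by positivity), mul_comm, htel]
end

section
/- Let n ≥ 3, let m_1,...,m_n > 0 be real numbers, and let 0 ≤ α_1 < α_2 < ... < α_n < 2π with α_{n+1} := α_1 + 2π, satisfying the minimal-gap condition α_2 − α_1 ≤ α_{i+1} − α_i for all i = 1,...,n. Suppose there is a nondegenerate open interval I ⊆ ℝ such that 2 − c_ji ρ > 0 for all ρ ∈ I and all i ≠ j, and such that for every ρ ∈ I we have δ_1(ρ) = δ_2(ρ) and γ_1(ρ) = γ_2(ρ). Then the polygon is regular: α_{i+1} − α_i = 2π/n for all i = 1,...,n. -/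
open Real Finset

open Polynomial in
/-- A finite family of weights all of whose power moments vanish has zero total weight on each
fibre of the nodes. -/
lemma sum_fiber_eq_zero_of_moments {ι : Type*} (J : Finset ι) (v x : ι → ℝ)
    (h : ∀ k : ℕ, ∑ j ∈ J, v j * x j ^ k = 0) (y : ℝ) :
    ∑ j ∈ J with x j = y, v j = 0 := by
  have hp : ∀ p : ℝ[X], ∑ j ∈ J, v j * p.eval (x j) = 0 := by
    intro p
    simp_rw [eval_eq_sum_range, Finset.mul_sum]
    rw [Finset.sum_comm]
    refine Finset.sum_eq_zero fun k _ => ?_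
    have := congrArg (p.coeff k * ·) (h k)
    simp only [Finset.mul_sum, mul_zero] at this
    rw [← this]
    exact Finset.sum_congr rfl fun j _ => by ring
  classical
  set P : ℝ[X] := ∏ z ∈ (J.image x).erase y, (X - C z)
  have hP : P.eval y ≠ 0 := by
    rw [eval_prod, Finset.prod_ne_zero_iff]
    intro z hz
    simpa [sub_eq_zero] using (Finset.ne_of_mem_erase hz).symm
  have hsum : (∑ j ∈ J with x j = y, v j) * P.eval y = 0 := by
    rw [← hp P, Finset.sum_mul, Finset.sum_filter]
    refine Finset.sum_congr rfl fun j hj => ?_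
    split_ifs with hjy
    · rw [hjy]
    · have : P.eval (x j) = 0 := by
        rw [eval_prod]
        exact Finset.prod_eq_zero
          (Finset.mem_erase.2 ⟨hjy, Finset.mem_image_of_mem x hj⟩) (by simp)
      rw [this, mul_zero]
  exact (mul_eq_zero.1 hsum).resolve_right hP

/-- The functions `ρ ↦ (2 - c ρ) ^ (-3/2)` for distinct `c` are linearly independent on any
nondegenerate open interval where they are defined. -/
lemma sum_fiber_eq_zero_of_sum_rpow {ι : Type*} (J : Finset ι) (w c : ι → ℝ) {a b : ℝ}
    (hab : a < b) (hpos : ∀ ρ ∈ Set.Ioo a b, ∀ j ∈ J, 0 < 2 - c j * ρ)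
    (h : ∀ ρ ∈ Set.Ioo a b, ∑ j ∈ J, w j * (2 - c j * ρ) ^ (-(3 / 2) : ℝ) = 0) (y : ℝ) :
    ∑ j ∈ J with c j = y, w j = 0 := by
  have hk : ∀ k : ℕ, ∀ ρ ∈ Set.Ioo a b,
      ∑ j ∈ J, w j * c j ^ k * (2 - c j * ρ) ^ (-(3 / 2) - k : ℝ) = 0 := by
    intro k
    induction k with
    | zero => simpa using h
    | succ k ih =>
      intro ρ hρ
      have hd : HasDerivAt (fun ρ => ∑ j ∈ J, w j * c j ^ k * (2 - c j * ρ) ^ (-(3 / 2) - k : ℝ))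
          (∑ j ∈ J, w j * c j ^ k *
            (-c j * (-(3 / 2) - k) * (2 - c j * ρ) ^ (-(3 / 2) - k - 1 : ℝ))) ρ := by
        refine HasDerivAt.fun_sum fun j hj => HasDerivAt.const_mul _ ?_
        refine HasDerivAt.rpow_const ?_ (Or.inl (hpos ρ hρ j hj).ne')
        simpa using ((hasDerivAt_id ρ).const_mul (c j)).const_sub 2
      have h0 := hd.unique ((hasDerivAt_const ρ (0 : ℝ)).congr_of_eventuallyEq
        (Filter.eventuallyEq_of_mem (isOpen_Ioo.mem_nhds hρ) ih))
      have hne : ((3 / 2) + k : ℝ) ≠ 0 := by positivity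
      refine (mul_eq_zero.1 (?_ : ((3 / 2) + k : ℝ) * _ = 0)).resolve_left hne
      rw [← h0, Finset.mul_sum]
      refine Finset.sum_congr rfl fun j _ => ?_
      rw [show (-(3 / 2) - ((k + 1 : ℕ) : ℝ) : ℝ) = -(3 / 2) - k - 1 by push_cast; ring]
      ring
  obtain ⟨ρ, hρ⟩ := Set.nonempty_Ioo.2 hab
  by_cases hJ : (J.filter fun j => c j = y).Nonempty
  swap
  · rw [Finset.not_nonempty_iff_eq_empty.1 hJ, Finset.sum_empty]
  obtain ⟨i, hi⟩ := hJ
  obtain ⟨hiJ, rfl⟩ := Finset.mem_filter.1 hi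
  have hm := sum_fiber_eq_zero_of_moments J (fun j => w j * (2 - c j * ρ) ^ (-(3 / 2) : ℝ))
    (fun j => c j / (2 - c j * ρ)) (fun k => by
      rw [← hk k ρ hρ]
      refine Finset.sum_congr rfl fun j hj => ?_
      rw [Real.rpow_sub (hpos ρ hρ j hj), Real.rpow_natCast, div_pow]
      ring) (c i / (2 - c i * ρ))
  have hfil : (J.filter fun j => c j / (2 - c j * ρ) = c i / (2 - c i * ρ)) =
      J.filter fun j => c j = c i := by
    refine Finset.filter_congr fun j hj => ?_
    rw [div_eq_div_iff (hpos ρ hρ j hj).ne' (hpos ρ hρ i hiJ).ne']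
    constructor <;> intro e <;> linarith
  rw [hfil] at hm
  have hne : (2 - c i * ρ) ^ (-(3 / 2) : ℝ) ≠ 0 := (Real.rpow_pos_of_pos (hpos ρ hρ i hiJ) _).ne'
  refine (mul_eq_zero.1 (?_ : _ * (2 - c i * ρ) ^ (-(3 / 2) : ℝ) = 0)).resolve_right hne
  rw [← hm, Finset.sum_mul]
  refine Finset.sum_congr rfl fun j hj => ?_
  rw [(Finset.mem_filter.1 hj).2]

/-- Two combinations of the functions `ρ ↦ (2 - c ρ) ^ (-3/2)` that agree on an interval have the
same total coefficient for each `c`. -/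
lemma sum_fiber_eq_of_sum_rpow_eq {ι : Type*} (J K : Finset ι) (w c v d : ι → ℝ) {a b : ℝ}
    (hab : a < b) (hpos : ∀ ρ ∈ Set.Ioo a b, ∀ j ∈ J, 0 < 2 - c j * ρ)
    (hpos' : ∀ ρ ∈ Set.Ioo a b, ∀ j ∈ K, 0 < 2 - d j * ρ)
    (h : ∀ ρ ∈ Set.Ioo a b, ∑ j ∈ J, w j * (2 - c j * ρ) ^ (-(3 / 2) : ℝ) =
      ∑ j ∈ K, v j * (2 - d j * ρ) ^ (-(3 / 2) : ℝ)) (y : ℝ) :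
    ∑ j ∈ J with c j = y, w j = ∑ j ∈ K with d j = y, v j := by
  have := sum_fiber_eq_zero_of_sum_rpow (J.disjSum K) (Sum.elim w fun j => -v j)
    (Sum.elim c d) hab
    (by
      intro ρ hρ j hj
      rcases Finset.mem_disjSum.1 hj with ⟨i, hi, rfl⟩ | ⟨i, hi, rfl⟩
      · exact hpos ρ hρ i hi
      · exact hpos' ρ hρ i hi)
    (by
      intro ρ hρ
      simp [Finset.sum_disjSum, h ρ hρ]) y
  rw [Finset.sum_filter, Finset.sum_disjSum] at this
  rw [Finset.sum_filter, Finset.sum_filter, ← sub_eq_zero, sub_eq_add_neg,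
    ← Finset.sum_neg_distrib]
  refine (congrArg₂ (· + ·) rfl (Finset.sum_congr rfl fun j _ => ?_)).trans this
  by_cases hj : d j = y <;> simp [hj]

lemma muF_eq (α : ℕ → ℝ) {ρ : ℝ} {j i : ℕ} (h : 0 < 2 - cAng α j i * ρ) :
    muF α ρ j i =
      1 / cAng α j i ^ ((1 : ℝ) / 2) * (2 - cAng α j i * ρ) ^ (-(3 / 2) : ℝ) := by
  rw [muF, Real.rpow_neg h.le, ← div_eq_mul_inv, div_div]

lemma nuF_eq (α : ℕ → ℝ) {ρ : ℝ} {j i : ℕ} (h : 0 < 2 - cAng α j i * ρ) :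
    nuF α ρ j i =
      sAng α j i / cAng α j i ^ ((3 : ℝ) / 2) * (2 - cAng α j i * ρ) ^ (-(3 / 2) : ℝ) := by
  rw [nuF, Real.rpow_neg h.le, ← div_eq_mul_inv, div_div]

lemma sAng_sq (α : ℕ → ℝ) (j i : ℕ) : sAng α j i ^ 2 = cAng α j i * (2 - cAng α j i) := by
  have := Real.sin_sq_add_cos_sq (α j - α i)
  simp only [sAng, cAng]
  linarith

/-- A common weighted count and a common weighted sum of sines on two level sets of `cAng`
force every direction occurring on the first level set to occur on the second. -/
lemma exists_eq_of_sum_eq (J K : Finset ℕ) (m α : ℕ → ℝ) (p q k : ℕ) (hk : k ∈ J)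
    (hJ : ∀ j ∈ J, 0 < m j)
    (h0 : ∑ j ∈ J with cAng α j p = cAng α k p, m j =
      ∑ j ∈ K with cAng α j q = cAng α k p, m j)
    (h1 : ∑ j ∈ J with cAng α j p = cAng α k p, m j * sAng α j p =
      ∑ j ∈ K with cAng α j q = cAng α k p, m j * sAng α j q) :
    ∃ j ∈ K, cAng α j q = cAng α k p ∧ sAng α j q = sAng α k p := by
  by_contra! hno
  set c := cAng α k p with hc
  set s := sAng α k p with hs
  have hkJ : k ∈ J.filter fun j => cAng α j p = c := Finset.mem_filter.2 ⟨hk, rfl⟩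
  have hneg : ∀ j ∈ K.filter fun j => cAng α j q = c, s ≠ 0 ∧ sAng α j q = -s := by
    intro j hj
    obtain ⟨hjK, hjc⟩ := Finset.mem_filter.1 hj
    have hsq : sAng α j q ^ 2 = s ^ 2 := by rw [sAng_sq, hs, sAng_sq, hjc]
    have hj' := (sq_eq_sq_iff_eq_or_eq_neg.1 hsq).resolve_left (hno j hjK hjc)
    refine ⟨fun hs0 => hno j hjK hjc ?_, hj'⟩
    rw [hj', hs0, neg_zero]
  by_cases hs0 : s = 0
  · have hempty : (K.filter fun j => cAng α j q = c) = ∅ :=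
      Finset.eq_empty_of_forall_notMem fun j hj => (hneg j hj).1 hs0
    rw [hempty, Finset.sum_empty] at h0
    exact (Finset.sum_pos (fun j hj => hJ j (Finset.mem_filter.1 hj).1) ⟨k, hkJ⟩).ne' h0
  · have hsum : ∑ j ∈ J with cAng α j p = c, m j * (s * (s + sAng α j p)) = 0 := by
      calc ∑ j ∈ J with cAng α j p = c, m j * (s * (s + sAng α j p))
          = s ^ 2 * ∑ j ∈ J with cAng α j p = c, m j +
            s * ∑ j ∈ J with cAng α j p = c, m j * sAng α j p := by
            rw [Finset.mul_sum, Finset.mul_sum, ← Finset.sum_add_distrib]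
            exact Finset.sum_congr rfl fun j _ => by ring
        _ = ∑ j ∈ K with cAng α j q = c, (s ^ 2 * m j + s * (m j * sAng α j q)) := by
            rw [h0, h1, Finset.mul_sum, Finset.mul_sum, ← Finset.sum_add_distrib]
        _ = 0 := Finset.sum_eq_zero fun j hj => by rw [(hneg j hj).2]; ring
    refine (Finset.sum_pos' (fun j hj => ?_) ⟨k, hkJ, ?_⟩).ne' hsum
    · obtain ⟨hjJ, hjc⟩ := Finset.mem_filter.1 hj
      have hsq : sAng α j p ^ 2 = s ^ 2 := by rw [sAng_sq, hs, sAng_sq, hjc]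
      exact mul_nonneg (hJ j hjJ).le (by nlinarith [sq_nonneg (s + sAng α j p)])
    · have : 0 < s ^ 2 := by positivity
      exact mul_pos (hJ k hk) (by rw [← hs]; nlinarith)

/-- If `δ_p = δ_q` and `γ_p = γ_q` on an interval, then every direction seen from vertex `p` is
also seen from vertex `q`. -/
lemma exists_same_direction (n : ℕ) (m : ℕ → ℝ) (hm : ∀ i ∈ Finset.Icc 1 n, 0 < m i)
    (α : ℕ → ℝ) {a b : ℝ} (hab : a < b) {p q k : ℕ}
    (hp : p ∈ Finset.Icc 1 n) (hq : q ∈ Finset.Icc 1 n)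
    (hpos : ∀ ρ ∈ Set.Ioo a b, ∀ i ∈ Finset.Icc 1 n, ∀ j ∈ Finset.Icc 1 n, j ≠ i →
      0 < 2 - cAng α j i * ρ)
    (hcrit : ∀ ρ ∈ Set.Ioo a b,
      deltaF n m α ρ p = deltaF n m α ρ q ∧ gammaF n m α ρ p = gammaF n m α ρ q)
    (hk : k ∈ (Finset.Icc 1 n).erase p) (hc : 0 < cAng α k p) :
    ∃ j ∈ (Finset.Icc 1 n).erase q,
      cAng α j q = cAng α k p ∧ sAng α j q = sAng α k p := by
  have hpos' : ∀ i ∈ Finset.Icc 1 n, ∀ ρ ∈ Set.Ioo a b, ∀ j ∈ (Finset.Icc 1 n).erase i,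
      0 < 2 - cAng α j i * ρ := fun i hi ρ hρ j hj =>
    hpos ρ hρ i hi j (Finset.mem_of_mem_erase hj) (Finset.ne_of_mem_erase hj)
  have hδ : ∀ i ∈ Finset.Icc 1 n, ∀ ρ ∈ Set.Ioo a b, deltaF n m α ρ i =
      ∑ j ∈ (Finset.Icc 1 n).erase i, m j * (1 / cAng α j i ^ ((1 : ℝ) / 2)) *
        (2 - cAng α j i * ρ) ^ (-(3 / 2) : ℝ) := fun i hi ρ hρ =>
    Finset.sum_congr rfl fun j hj => by rw [muF_eq α (hpos' i hi ρ hρ j hj), mul_assoc]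
  have hγ : ∀ i ∈ Finset.Icc 1 n, ∀ ρ ∈ Set.Ioo a b, gammaF n m α ρ i =
      ∑ j ∈ (Finset.Icc 1 n).erase i, m j * (sAng α j i / cAng α j i ^ ((3 : ℝ) / 2)) *
        (2 - cAng α j i * ρ) ^ (-(3 / 2) : ℝ) := fun i hi ρ hρ =>
    Finset.sum_congr rfl fun j hj => by rw [nuF_eq α (hpos' i hi ρ hρ j hj), mul_assoc]
  have e0 := sum_fiber_eq_of_sum_rpow_eq _ _ _ _ _ _ hab (hpos' p hp) (hpos' q hq)
    (fun ρ hρ => by rw [← hδ p hp ρ hρ, ← hδ q hq ρ hρ]; exact (hcrit ρ hρ).1) (cAng α k p)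
  have e1 := sum_fiber_eq_of_sum_rpow_eq _ _ _ _ _ _ hab (hpos' p hp) (hpos' q hq)
    (fun ρ hρ => by rw [← hγ p hp ρ hρ, ← hγ q hq ρ hρ]; exact (hcrit ρ hρ).2) (cAng α k p)
  have f0 : ∀ i, ∑ j ∈ (Finset.Icc 1 n).erase i with cAng α j i = cAng α k p,
      m j * (1 / cAng α j i ^ ((1 : ℝ) / 2)) =
      (∑ j ∈ (Finset.Icc 1 n).erase i with cAng α j i = cAng α k p, m j) /
        cAng α k p ^ ((1 : ℝ) / 2) := fun i => by
    rw [Finset.sum_div]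
    refine Finset.sum_congr rfl fun j hj => ?_
    rw [(Finset.mem_filter.1 hj).2]
    ring
  have f1 : ∀ i, ∑ j ∈ (Finset.Icc 1 n).erase i with cAng α j i = cAng α k p,
      m j * (sAng α j i / cAng α j i ^ ((3 : ℝ) / 2)) =
      (∑ j ∈ (Finset.Icc 1 n).erase i with cAng α j i = cAng α k p, m j * sAng α j i) /
        cAng α k p ^ ((3 : ℝ) / 2) := fun i => by
    rw [Finset.sum_div]
    refine Finset.sum_congr rfl fun j hj => ?_
    rw [(Finset.mem_filter.1 hj).2]
    ring
  rw [f0, f0, div_left_inj' (Real.rpow_pos_of_pos hc _).ne'] at e0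
  rw [f1, f1, div_left_inj' (Real.rpow_pos_of_pos hc _).ne'] at e1
  exact exists_eq_of_sum_eq _ _ m α p q k hk
    (fun j hj => hm j (Finset.mem_of_mem_erase hj)) e0 e1

/-- Under the minimal-gap normalization `α_2 − α_1 ≤ α_{i+1} − α_i`, if
`δ_1 = δ_2` and `γ_1 = γ_2` hold on a nondegenerate open interval of values of `ρ`,
then the polygon is regular: `α_{i+1} − α_i = 2π/n` for all `i`. -/
theorem regular_of_two_equalities_on_interval
    (n : ℕ) (hn : 3 ≤ n)
    (m : ℕ → ℝ) (hm : ∀ i ∈ Finset.Icc 1 n, 0 < m i)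
    (α : ℕ → ℝ)
    (hα0 : 0 ≤ α 1)
    (hαmono : ∀ i, 1 ≤ i → i < n → α i < α (i + 1))
    (hαlt : α n < 2 * π)
    (hαext : α (n + 1) = α 1 + 2 * π)
    (hgap : ∀ i ∈ Finset.Icc 1 n, α 2 - α 1 ≤ α (i + 1) - α i)
    (a b : ℝ) (hab : a < b)
    (hpos : ∀ ρ ∈ Set.Ioo a b, ∀ i ∈ Finset.Icc 1 n, ∀ j ∈ Finset.Icc 1 n, j ≠ i →
      0 < 2 - cAng α j i * ρ)
    (hcrit : ∀ ρ ∈ Set.Ioo a b,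
      deltaF n m α ρ 1 = deltaF n m α ρ 2 ∧ gammaF n m α ρ 1 = gammaF n m α ρ 2) :
    ∀ i ∈ Finset.Icc 1 n, α (i + 1) - α i = 2 * π / n := by
  have hstep : ∀ i, 1 ≤ i → i ≤ n → α i < α (i + 1) := by
    intro i h1 hi
    rcases hi.lt_or_eq with h | rfl
    · exact hαmono i h1 h
    · rw [hαext]; linarith
  have hmono : StrictMonoOn α (Set.Icc 1 (n + 1)) := by
    refine strictMonoOn_of_lt_add_one Set.ordConnected_Icc fun i _ hi hi' => ?_
    exact hstep i hi.1 (by have := hi'.2; omega)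
  have hle : ∀ i j, 1 ≤ i → i ≤ j → j ≤ n + 1 → α i ≤ α j := fun i j h1 hij hj =>
    hmono.monotoneOn ⟨h1, hij.trans hj⟩ ⟨h1.trans hij, hj⟩ hij
  have hnext : ∀ k, 2 ≤ k → k ≤ n → α (k + 1) = α k + (α 2 - α 1) := by
    intro k hk2 hkn
    have h1k : α 1 < α k := hmono ⟨le_rfl, by omega⟩ ⟨by omega, by omega⟩ (by omega)
    have hk_lt := hle k n (by omega) hkn (by omega)
    have hg := hgap k (Finset.mem_Icc.2 ⟨by omega, hkn⟩)
    have h12 := hstep 1 le_rfl (by omega)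
    have hk1 := hle (k + 1) (n + 1) (by omega) (by omega) le_rfl
    have hc : 0 < cAng α k 1 := by
      have hne : Real.cos (α k - α 1) ≠ 1 := fun h => by
        have := (Real.cos_eq_one_iff_of_lt_of_lt (by linarith) (by linarith)).1 h
        linarith
      exact sub_pos.2 (lt_of_le_of_ne (Real.cos_le_one _) hne)
    obtain ⟨j, hj, hjc, hjs⟩ := exists_same_direction n m hm α hab (p := 1) (q := 2) (k := k)
      (Finset.mem_Icc.2 ⟨le_rfl, by omega⟩) (Finset.mem_Icc.2 ⟨by omega, by omega⟩) hpos hcrit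
      (Finset.mem_erase.2 ⟨by omega, Finset.mem_Icc.2 ⟨by omega, hkn⟩⟩) hc
    obtain ⟨hj1, hjn⟩ := Finset.mem_Icc.1 (Finset.mem_of_mem_erase hj)
    obtain ⟨z, hz⟩ := Real.Angle.angle_eq_iff_two_pi_dvd_sub.1
      (Real.Angle.cos_sin_inj (sub_right_injective hjc) hjs)
    have hj_ge := hle 1 j le_rfl hj1 (by omega)
    have hj_lt := hle j n hj1 hjn (by omega)
    refine le_antisymm ?_ (by linarith)
    have hz_lt : z < 1 := by
      have : (z : ℝ) < 1 := by nlinarith [Real.pi_pos]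
      exact_mod_cast this
    rcases (show z = 0 ∨ z ≤ -1 by omega) with rfl | hz'
    · have hjk : k < j := by
        by_contra! hjk
        have := hle j k hj1 hjk (by omega)
        norm_num at hz
        linarith
      have := hle (k + 1) j (by omega) hjk (by omega)
      norm_num at hz
      linarith
    · have : (z : ℝ) ≤ -1 := by exact_mod_cast hz'
      nlinarith [Real.pi_pos]
  have hgaps : ∀ i ∈ Finset.Icc 1 n, α (i + 1) - α i = α 2 - α 1 := by
    intro i hi
    obtain ⟨h1, hin⟩ := Finset.mem_Icc.1 hi
    rcases h1.eq_or_lt with rfl | h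
    · rfl
    · rw [hnext i h hin]; ring
  have htotal : n * (α 2 - α 1) = 2 * π := by
    have htel := Finset.sum_Ico_sub α (show 1 ≤ n + 1 by omega)
    rw [Finset.sum_congr rfl fun i hi => hgaps i (by simp at hi ⊢; omega)] at htel
    simpa [hαext, mul_sub] using htel
  intro i hi
  rw [hgaps i hi, eq_div_iff (by positivity)]
  linarith
end

section
/- Let n ≥ 3 and let 0 ≤ α_1 < α_2 < ... < α_n < 2π with α_{n+1} := α_1 + 2π, satisfying the minimal-gap condition α_2 − α_1 ≤ α_{i+1} − α_i for all i = 1,...,n. If for every j ∈ {2,...,n} there exists u ∈ {1,...,n}, u ≠ 2, with α_j − α_1 ≡ α_u − α_2 (mod 2π), then α_{j+1} − α_j = 2π/n for all j = 1,...,n, i.e., the polygon with vertices at angles α_1,...,α_n is regular. -/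
open Real Finset

/-- `a ≡ b (mod 2π)`: the difference `a − b` is an integer multiple of `2π`. -/
def CongMod2Pi (a b : ℝ) : Prop := ∃ k : ℤ, a - b = k * (2 * Real.pi)

theorem lt_of_step_lt {f : ℕ → ℝ} {a b : ℕ} (h : ∀ i, a ≤ i → i < b → f i < f (i + 1))
    {i j : ℕ} (hi : a ≤ i) (hij : i < j) (hj : j ≤ b) : f i < f j := by
  induction j, hij using Nat.le_induction with
  | base => exact h i hi hj
  | succ k hk ih => exact (ih (by omega)).trans (h k (by omega) (by omega))

/-- Under the minimal-gap normalization, if for every `j ∈ {2,…,n}` there exists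
`u ∈ {1,…,n}`, `u ≠ 2`, with `α_j − α_1 ≡ α_u − α_2 (mod 2π)`, then the polygon
is regular: `α_{j+1} − α_j = 2π/n` for all `j`. -/
theorem regular_of_all_congruent_shift
    (n : ℕ) (hn : 3 ≤ n)
    (α : ℕ → ℝ)
    (hα0 : 0 ≤ α 1)
    (hαmono : ∀ i, 1 ≤ i → i < n → α i < α (i + 1))
    (hαlt : α n < 2 * π)
    (hαext : α (n + 1) = α 1 + 2 * π)
    (hgap : ∀ i ∈ Finset.Icc 1 n, α 2 - α 1 ≤ α (i + 1) - α i)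
    (hall : ∀ j ∈ Finset.Icc 2 n, ∃ u ∈ Finset.Icc 1 n, u ≠ 2 ∧
      CongMod2Pi (α j - α 1) (α u - α 2)) :
    ∀ j ∈ Finset.Icc 1 n, α (j + 1) - α j = 2 * π / n := by
  have hpi := Real.pi_pos
  have hstep : ∀ i, 1 ≤ i → i < n + 1 → α i < α (i + 1) := by
    intro i hi hin
    rcases Nat.lt_succ_iff_lt_or_eq.mp hin with h | rfl
    · exact hαmono i hi h
    · linarith
  have hlt {i j : ℕ} (hi : 1 ≤ i) (hij : i < j) (hj : j ≤ n + 1) : α i < α j :=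
    lt_of_step_lt hstep hi hij hj
  have hle {i j : ℕ} (hi : 1 ≤ i) (hij : i ≤ j) (hj : j ≤ n + 1) : α i ≤ α j := by
    rcases hij.eq_or_lt with rfl | h
    · exact le_rfl
    · exact (hlt hi h hj).le
  have hd : α 1 < α 2 := hlt le_rfl (by omega) (by omega)
  have hgapEq : ∀ j, 1 ≤ j → j ≤ n → α (j + 1) - α j = α 2 - α 1 := by
    intro j hj hjn
    rcases hj.eq_or_lt with rfl | hj2
    · rfl
    obtain ⟨u, hu, -, k, hk⟩ := hall j (Finset.mem_Icc.mpr ⟨hj2, hjn⟩)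
    obtain ⟨hu1, hun⟩ := Finset.mem_Icc.mp hu
    have hmin := hgap j (Finset.mem_Icc.mpr ⟨hj, hjn⟩)
    have hjTop : α (j + 1) ≤ α (n + 1) := hle (by omega) (by omega) le_rfl
    have hjBot : α 1 < α j := hlt le_rfl hj2 (by omega)
    have huBot : α 1 ≤ α u := hle le_rfl hu1 (by omega)
    have huTop : α u < α (n + 1) := hlt hu1 (by omega) le_rfl
    have hk0 : (-1 : ℤ) < k := by
      by_contra! h
      have : (k : ℝ) ≤ -1 := by exact_mod_cast h
      nlinarith
    have hk1 : k < 2 := by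
      by_contra! h
      have : (2 : ℝ) ≤ k := by exact_mod_cast h
      nlinarith
    obtain rfl | rfl : k = 0 ∨ k = 1 := by omega
    · have hju : j < u := by
        by_contra! h
        have := hle hu1 h (by omega)
        push_cast at hk
        linarith
      have := hle (by omega) (Nat.succ_le_of_lt hju) (by omega)
      push_cast at hk
      simp only [Nat.succ_eq_add_one] at this
      linarith
    · push_cast at hk
      linarith
  have hsum : ∀ m : ℕ, m ≤ n → α (m + 1) = α 1 + m * (α 2 - α 1) := by
    intro m
    induction m with
    | zero => simp
    | succ m ih =>
      intro hm
      have h₁ := ih (by omega)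
      have h₂ := hgapEq (m + 1) (by omega) hm
      push_cast
      linarith
  intro j hj
  obtain ⟨hj1, hjn⟩ := Finset.mem_Icc.mp hj
  have hn0 : (n : ℝ) ≠ 0 := by
    exact_mod_cast (by omega : n ≠ 0)
  rw [hgapEq j hj1 hjn, eq_div_iff hn0]
  linarith [hsum n le_rfl]
end

section
/- Let n ≥ 3 and let 0 ≤ α_1 < α_2 < ... < α_n < 2π with α_{n+1} := α_1 + 2π, satisfying the minimal-gap condition α_2 − α_1 ≤ α_{i+1} − α_i for all i = 1,...,n. If the polygon is irregular, i.e., the gaps α_{i+1} − α_i (i = 1,...,n) are not all equal, then there exists j ∈ {2,...,n} such that for every u ∈ {1,...,n} with u ≠ 2 one has α_j − α_1 ≢ α_u − α_2 (mod 2π), while 1 − cos(α_j − α_1) = 1 − cos(α_u − α_2) for some u ∈ {1,...,n}, u ≠ 2, can hold only via α_j − α_1 ≡ α_2 − α_u (mod 2π). -/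
open Real Finset

/-- A finite sequence of reals that increases at each step is monotone. -/
theorem le_of_lt_succ_of_le {n : ℕ} {α : ℕ → ℝ}
    (h : ∀ i, 1 ≤ i → i < n → α i < α (i + 1)) {a b : ℕ} (ha : 1 ≤ a) (hab : a ≤ b)
    (hb : b ≤ n) : α a ≤ α b := by
  induction b, hab using Nat.le_induction with
  | base => exact le_rfl
  | succ b hab ih => exact (ih (by lia)).trans (h b (by lia) (by lia)).le

/-- If the polygon is irregular (the gaps `α_{i+1} − α_i` are not all equal), then,
under the minimal-gap normalization, there exists `j ∈ {2,…,n}` such that no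
`u ∈ {1,…,n}`, `u ≠ 2`, satisfies `α_j − α_1 ≡ α_u − α_2 (mod 2π)`, while any
coincidence `1 − cos(α_j − α_1) = 1 − cos(α_u − α_2)` with `u ≠ 2` can only occur
via `α_j − α_1 ≡ α_2 − α_u (mod 2π)`. -/
theorem exists_bad_index_of_irregular
    (n : ℕ) (hn : 3 ≤ n)
    (α : ℕ → ℝ)
    (hα0 : 0 ≤ α 1)
    (hαmono : ∀ i, 1 ≤ i → i < n → α i < α (i + 1))
    (hαlt : α n < 2 * π)
    (hαext : α (n + 1) = α 1 + 2 * π)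
    (hgap : ∀ i ∈ Finset.Icc 1 n, α 2 - α 1 ≤ α (i + 1) - α i)
    (hirr : ¬ ∀ i ∈ Finset.Icc 1 n, ∀ i' ∈ Finset.Icc 1 n,
      α (i + 1) - α i = α (i' + 1) - α i') :
    ∃ j ∈ Finset.Icc 2 n,
      (∀ u ∈ Finset.Icc 1 n, u ≠ 2 → ¬ CongMod2Pi (α j - α 1) (α u - α 2)) ∧
      (∀ u ∈ Finset.Icc 1 n, u ≠ 2 →
        1 - Real.cos (α j - α 1) = 1 - Real.cos (α u - α 2) →
        CongMod2Pi (α j - α 1) (α 2 - α u)) := by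
  obtain ⟨j, hj, hjgap⟩ : ∃ j ∈ Finset.Icc 1 n, α 2 - α 1 ≠ α (j + 1) - α j := by
    by_contra! h
    exact hirr fun i hi i' hi' => (h i hi).symm.trans (h i' hi')
  have hlt := lt_of_le_of_ne (hgap j hj) hjgap
  have hj1 : j ≠ 1 := fun h => hjgap (by rw [h])
  rw [Finset.mem_Icc] at hj
  have h12 := hαmono 1 le_rfl (by lia)
  have h1j := le_of_lt_succ_of_le hαmono le_rfl hj.1 hj.2
  have hsucc : α (j + 1) ≤ α 1 + 2 * π := by
    rcases hj.2.lt_or_eq with h | h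
    · linarith [le_of_lt_succ_of_le hαmono (by lia) h le_rfl]
    · rw [h, hαext]
  have hbad : ∀ u ∈ Finset.Icc 1 n, ¬ CongMod2Pi (α j - α 1) (α u - α 2) := by
    rintro u hu ⟨k, hk⟩
    rw [Finset.mem_Icc] at hu
    have h1u := le_of_lt_succ_of_le hαmono le_rfl hu.1 hu.2
    have hun := le_of_lt_succ_of_le hαmono hu.1 hu.2 le_rfl
    norm_num at h12
    have hk1 : (k : ℝ) < 1 := by
      by_contra! h
      nlinarith [Real.pi_pos]
    have hk2 : (-1 : ℝ) < k := by
      by_contra! h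
      nlinarith [Real.pi_pos]
    have hk0 : k = 0 := by
      have h1 : k < 1 := by exact_mod_cast hk1
      have h2 : -1 < k := by exact_mod_cast hk2
      lia
    rw [hk0, Int.cast_zero, zero_mul] at hk
    rcases le_or_gt u j with h | h
    · linarith [le_of_lt_succ_of_le hαmono hu.1 h hj.2]
    · linarith [le_of_lt_succ_of_le hαmono (by lia) h hu.2]
  refine ⟨j, Finset.mem_Icc.2 ⟨by lia, hj.2⟩, fun u hu _ => hbad u hu, fun u hu _ hcos => ?_⟩
  obtain ⟨k, hk | hk⟩ := Real.cos_eq_cos_iff.1 (sub_right_injective hcos)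
  · exact (hbad u hu ⟨-k, by push_cast; linarith⟩).elim
  · exact ⟨k, by linarith⟩
end
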